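/- (Cut elimination for the simplified system) For every sequent Γ⇒Δ provable in the simplified system GPFL=^{IS} there is a proof of Γ⇒Δ in GPFL=^{IS} that contains no application of the Cut rule. -/

import Mathlib

/-!
Deep embedding of the language of classical positive free logic with the
binary quantifier `I` for definite descriptions (`Ix[F,G]`, "the F is G"),
and of Indrzejczak's sequent calculus GPFL= extended by the rules for `I`
(the system GPFL=^I of Kürbis).  Bound variables are de Bruijn indices,
free variables are "parameters" (natural numbers).
-/

/-- A first-order signature: function symbols and predicate symbols with arities. -/
structure Sig where
  Fn : Type
  fnAr : Fn → ℕ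
  Pr : Type
  prAr : Pr → ℕ

/-- Terms: parameters, constants, (de Bruijn) bound variables and function terms. -/
inductive Tm (σ : Sig) : Type
  | par : ℕ → Tm σ
  | const : ℕ → Tm σ
  | bvar : ℕ → Tm σ
  | func : (f : σ.Fn) → (Fin (σ.fnAr f) → Tm σ) → Tm σ

namespace Tm

variable {σ : Sig}

/-- Lift (shift up by one) the bound variables `≥ c`. -/
def lift (c : ℕ) : Tm σ → Tm σ
  | par a => par a
  | const k => const k
  | bvar n => if n < c then bvar n else bvar (n + 1)
  | func f ts => func f fun i => (ts i).lift c

/-- Substitute the term `u` for the bound variable `k`. -/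
def inst (k : ℕ) (u : Tm σ) : Tm σ → Tm σ
  | par a => par a
  | const c => const c
  | bvar n => if n = k then u else if k < n then bvar (n - 1) else bvar n
  | func f ts => func f fun i => inst k u (ts i)

/-- Substitute the term `u` for the parameter `a`. -/
def substPar (a : ℕ) (u : Tm σ) : Tm σ → Tm σ
  | par b => if b = a then u else par b
  | const c => const c
  | bvar n => bvar n
  | func f ts => func f fun i => substPar a u (ts i)

/-- The set of parameters occurring in a term. -/
def pars : Tm σ → Set ℕ
  | par a => {a}
  | const _ => ∅
  | bvar _ => ∅
  | func _ ts => ⋃ i, (ts i).pars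

/-- A term is `ClosedB` if it contains no (dangling) bound variables; genuine
terms of the language are of this kind, and such a term is automatically
free for any variable in any formula. -/
def ClosedB : Tm σ → Prop
  | par _ => True
  | const _ => True
  | bvar _ => False
  | func _ ts => ∀ i, (ts i).ClosedB

end Tm

/-- Formulas, including the existence predicate `ext t` (`∃!t`) and the binary
quantifier `iq F G` (`Ix[F,G]`), which binds the de Bruijn variable `0` in
both `F` and `G`. -/
inductive Fml (σ : Sig) : Type
  | atom : (p : σ.Pr) → (Fin (σ.prAr p) → Tm σ) → Fml σ
  | eq : Tm σ → Tm σ → Fml σ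
  | ext : Tm σ → Fml σ
  | neg : Fml σ → Fml σ
  | conj : Fml σ → Fml σ → Fml σ
  | disj : Fml σ → Fml σ → Fml σ
  | imp : Fml σ → Fml σ → Fml σ
  | all : Fml σ → Fml σ
  | ex : Fml σ → Fml σ
  | iq : Fml σ → Fml σ → Fml σ

namespace Fml

variable {σ : Sig}

/-- Lift (shift up by one) the bound variables `≥ c`. -/
def lift (c : ℕ) : Fml σ → Fml σ
  | atom p ts => atom p fun i => (ts i).lift c
  | eq t s => eq (t.lift c) (s.lift c)
  | ext t => ext (t.lift c)
  | neg A => neg (A.lift c)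
  | conj A B => conj (A.lift c) (B.lift c)
  | disj A B => disj (A.lift c) (B.lift c)
  | imp A B => imp (A.lift c) (B.lift c)
  | all A => all (A.lift (c + 1))
  | ex A => ex (A.lift (c + 1))
  | iq F G => iq (F.lift (c + 1)) (G.lift (c + 1))

/-- Substitute the term `u` for the bound variable `k`. -/
def inst (k : ℕ) (u : Tm σ) : Fml σ → Fml σ
  | atom p ts => atom p fun i => Tm.inst k u (ts i)
  | eq t s => eq (Tm.inst k u t) (Tm.inst k u s)
  | ext t => ext (Tm.inst k u t)
  | neg A => neg (A.inst k u)
  | conj A B => conj (A.inst k u) (B.inst k u)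
  | disj A B => disj (A.inst k u) (B.inst k u)
  | imp A B => imp (A.inst k u) (B.inst k u)
  | all A => all (A.inst (k + 1) (u.lift 0))
  | ex A => ex (A.inst (k + 1) (u.lift 0))
  | iq F G => iq (F.inst (k + 1) (u.lift 0)) (G.inst (k + 1) (u.lift 0))

/-- `A.inst0 t` is `A[t/x]`: the result of substituting `t` for the
outermost bound variable `x` (de Bruijn index 0) of `A`. -/
def inst0 (A : Fml σ) (u : Tm σ) : Fml σ := A.inst 0 u

/-- Substitute the term `u` for the parameter `a`. -/
def substPar (a : ℕ) (u : Tm σ) : Fml σ → Fml σ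
  | atom p ts => atom p fun i => Tm.substPar a u (ts i)
  | eq t s => eq (Tm.substPar a u t) (Tm.substPar a u s)
  | ext t => ext (Tm.substPar a u t)
  | neg A => neg (A.substPar a u)
  | conj A B => conj (A.substPar a u) (B.substPar a u)
  | disj A B => disj (A.substPar a u) (B.substPar a u)
  | imp A B => imp (A.substPar a u) (B.substPar a u)
  | all A => all (A.substPar a u)
  | ex A => ex (A.substPar a u)
  | iq F G => iq (F.substPar a u) (G.substPar a u)

/-- The set of parameters occurring in a formula. -/
def pars : Fml σ → Set ℕ
  | atom _ ts => ⋃ i, (ts i).pars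
  | eq t s => t.pars ∪ s.pars
  | ext t => t.pars
  | neg A => A.pars
  | conj A B => A.pars ∪ B.pars
  | disj A B => A.pars ∪ B.pars
  | imp A B => A.pars ∪ B.pars
  | all A => A.pars
  | ex A => A.pars
  | iq F G => F.pars ∪ G.pars

/-- The degree of a formula: the number of logical operators occurring in it;
`∃!t` counts as atomic (degree 0). -/
def deg : Fml σ → ℕ
  | atom _ _ => 0
  | eq _ _ => 0
  | ext _ => 0
  | neg A => A.deg + 1
  | conj A B => A.deg + B.deg + 1
  | disj A B => A.deg + B.deg + 1
  | imp A B => A.deg + B.deg + 1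
  | all A => A.deg + 1
  | ex A => A.deg + 1
  | iq F G => F.deg + G.deg + 1

/-- Atomic formulas: predications, identities and existence statements. -/
def Atomic : Fml σ → Prop
  | atom _ _ => True
  | eq _ _ => True
  | ext _ => True
  | _ => False

/-- `A ↔ B` abbreviates `(A → B) ∧ (B → A)`. -/
def iff (A B : Fml σ) : Fml σ := conj (imp A B) (imp B A)

/-- The formula `∃!x` (with `x` the variable bound by the surrounding
binder), used as the second argument of `I` in `Ix[F, ∃!x]`. -/
def exG : Fml σ := ext (Tm.bvar 0)

end Fml

/-- The parameter `a` does not occur in any formula of `Γ`. -/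
def FreshM {σ : Sig} (a : ℕ) (Γ : Multiset (Fml σ)) : Prop := ∀ B ∈ Γ, a ∉ B.pars

/-- Derivability in the simplified system GPFL=^{IS}: Indrzejczak's sequent
calculus GPFL= for classical positive free logic with identity, extended by
the simplified rules (RI^S), (LI^{1S}), (LI^{2SI}), (LI³), (LI^{4SI}),
(LI^{5S}) for the binary quantifier `I`.  The parameter `P` constrains the
cut formulas: every cut formula must satisfy `P` (so `fun _ => True` puts no
constraint and `fun _ => False` means cut-free). -/
inductive DerS (σ : Sig) (P : Fml σ → Prop) :
    Multiset (Fml σ) → Multiset (Fml σ) → Prop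
  | ax (A : Fml σ) : DerS σ P {A} {A}
  | cut {Γ Θ Δ Λ : Multiset (Fml σ)} (A : Fml σ) :
      DerS σ P Γ (A ::ₘ Θ) → DerS σ P (A ::ₘ Δ) Λ → P A →
      DerS σ P (Γ + Δ) (Θ + Λ)
  | lw {Γ Δ : Multiset (Fml σ)} (A : Fml σ) :
      DerS σ P Γ Δ → DerS σ P (A ::ₘ Γ) Δ
  | rw {Γ Δ : Multiset (Fml σ)} (A : Fml σ) :
      DerS σ P Γ Δ → DerS σ P Γ (A ::ₘ Δ)
  | lc {Γ Δ : Multiset (Fml σ)} (A : Fml σ) :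
      DerS σ P (A ::ₘ A ::ₘ Γ) Δ → DerS σ P (A ::ₘ Γ) Δ
  | rc {Γ Δ : Multiset (Fml σ)} (A : Fml σ) :
      DerS σ P Γ (A ::ₘ A ::ₘ Δ) → DerS σ P Γ (A ::ₘ Δ)
  | lneg {Γ Δ : Multiset (Fml σ)} (A : Fml σ) :
      DerS σ P Γ (A ::ₘ Δ) → DerS σ P (A.neg ::ₘ Γ) Δ
  | rneg {Γ Δ : Multiset (Fml σ)} (A : Fml σ) :
      DerS σ P (A ::ₘ Γ) Δ → DerS σ P Γ (A.neg ::ₘ Δ)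
  | land {Γ Δ : Multiset (Fml σ)} (A B : Fml σ) :
      DerS σ P (A ::ₘ B ::ₘ Γ) Δ → DerS σ P ((A.conj B) ::ₘ Γ) Δ
  | rand {Γ Δ : Multiset (Fml σ)} (A B : Fml σ) :
      DerS σ P Γ (A ::ₘ Δ) → DerS σ P Γ (B ::ₘ Δ) →
      DerS σ P Γ ((A.conj B) ::ₘ Δ)
  | lor {Γ Δ : Multiset (Fml σ)} (A B : Fml σ) :
      DerS σ P (A ::ₘ Γ) Δ → DerS σ P (B ::ₘ Γ) Δ →
      DerS σ P ((A.disj B) ::ₘ Γ) Δ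
  | ror {Γ Δ : Multiset (Fml σ)} (A B : Fml σ) :
      DerS σ P Γ (A ::ₘ B ::ₘ Δ) → DerS σ P Γ ((A.disj B) ::ₘ Δ)
  | limp {Γ Δ : Multiset (Fml σ)} (A B : Fml σ) :
      DerS σ P Γ (A ::ₘ Δ) → DerS σ P (B ::ₘ Γ) Δ →
      DerS σ P ((A.imp B) ::ₘ Γ) Δ
  | rimp {Γ Δ : Multiset (Fml σ)} (A B : Fml σ) :
      DerS σ P (A ::ₘ Γ) (B ::ₘ Δ) → DerS σ P Γ ((A.imp B) ::ₘ Δ)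
  | lall {Γ Δ : Multiset (Fml σ)} (A : Fml σ) (t : Tm σ) :
      DerS σ P ((A.inst0 t) ::ₘ Γ) Δ →
      DerS σ P ((Fml.ext t) ::ₘ (Fml.all A) ::ₘ Γ) Δ
  | rall {Γ Δ : Multiset (Fml σ)} (A : Fml σ) (a : ℕ) :
      FreshM a Γ → FreshM a Δ → a ∉ A.pars →
      DerS σ P ((Fml.ext (.par a)) ::ₘ Γ) ((A.inst0 (.par a)) ::ₘ Δ) →
      DerS σ P Γ ((Fml.all A) ::ₘ Δ)
  | lex {Γ Δ : Multiset (Fml σ)} (A : Fml σ) (a : ℕ) :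
      FreshM a Γ → FreshM a Δ → a ∉ A.pars →
      DerS σ P ((Fml.ext (.par a)) ::ₘ (A.inst0 (.par a)) ::ₘ Γ) Δ →
      DerS σ P ((Fml.ex A) ::ₘ Γ) Δ
  | rex {Γ Δ : Multiset (Fml σ)} (A : Fml σ) (t : Tm σ) :
      DerS σ P Γ ((A.inst0 t) ::ₘ Δ) →
      DerS σ P ((Fml.ext t) ::ₘ Γ) ((Fml.ex A) ::ₘ Δ)
  | eqI {Γ Δ : Multiset (Fml σ)} (A : Fml σ) (t₁ t₂ : Tm σ) :
      A.Atomic →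
      DerS σ P ((A.inst0 t₂) ::ₘ Γ) Δ →
      DerS σ P ((Fml.eq t₁ t₂) ::ₘ (A.inst0 t₁) ::ₘ Γ) Δ
  | eqE {Γ Δ : Multiset (Fml σ)} (t : Tm σ) :
      DerS σ P ((Fml.eq t t) ::ₘ Γ) Δ → DerS σ P Γ Δ
  | riS {Γ Δ : Multiset (Fml σ)} (F G : Fml σ) (t : Tm σ) (a : ℕ) :
      FreshM a Γ → FreshM a Δ → a ∉ F.pars → a ∉ G.pars → a ∉ t.pars →
      DerS σ P Γ ((F.inst0 t) ::ₘ Δ) →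
      DerS σ P Γ ((G.inst0 t) ::ₘ Δ) →
      DerS σ P ((Fml.ext (.par a)) ::ₘ (F.inst0 (.par a)) ::ₘ Γ)
        ((Fml.eq (.par a) t) ::ₘ Δ) →
      DerS σ P ((Fml.ext t) ::ₘ Γ) ((Fml.iq F G) ::ₘ Δ)
  | li1S {Γ Δ : Multiset (Fml σ)} (F G : Fml σ) (t : Tm σ) (a b : ℕ) :
      FreshM a Γ → FreshM a Δ → a ∉ F.pars → a ∉ G.pars → a ∉ t.pars →
      FreshM b Γ → FreshM b Δ → b ∉ F.pars → b ∉ G.pars → b ∉ t.pars →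
      DerS σ P Γ ((F.inst0 t) ::ₘ Δ) →
      DerS σ P ((F.inst0 (.par a)) ::ₘ (Fml.ext (.par a)) ::ₘ Γ)
        ((Fml.eq (.par a) t) ::ₘ Δ) →
      DerS σ P ((F.inst0 (.par b)) ::ₘ (G.inst0 (.par b)) ::ₘ (Fml.ext (.par b)) ::ₘ Γ) Δ →
      DerS σ P ((Fml.ext t) ::ₘ (Fml.iq F G) ::ₘ Γ) Δ
  | li2SI {Γ Δ : Multiset (Fml σ)} (F : Fml σ) (t₁ t₂ : Tm σ) :
      DerS σ P Γ ((F.inst0 t₁) ::ₘ Δ) →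
      DerS σ P Γ ((F.inst0 t₂) ::ₘ Δ) →
      DerS σ P ((Fml.eq t₁ t₂) ::ₘ Γ) Δ →
      DerS σ P ((Fml.ext t₁) ::ₘ (Fml.ext t₂) ::ₘ (Fml.iq F Fml.exG) ::ₘ Γ) Δ
  | li3 {Γ Δ : Multiset (Fml σ)} (F : Fml σ) (a : ℕ) :
      FreshM a Γ → FreshM a Δ → a ∉ F.pars →
      DerS σ P ((F.inst0 (.par a)) ::ₘ (Fml.ext (.par a)) ::ₘ Γ) Δ →
      DerS σ P ((Fml.iq F Fml.exG) ::ₘ Γ) Δ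
  | li4SI {Γ Δ : Multiset (Fml σ)} (F : Fml σ) (t₁ t₂ : Tm σ) :
      DerS σ P Γ ((F.inst0 t₁) ::ₘ Δ) →
      DerS σ P ((Fml.eq t₁ t₂) ::ₘ Γ) Δ →
      DerS σ P ((Fml.ext t₁) ::ₘ (Fml.ext t₂) ::ₘ
        (Fml.iq F (Fml.eq (.bvar 0) (t₂.lift 0))) ::ₘ Γ) Δ
  | li5S {Γ Δ : Multiset (Fml σ)} (F : Fml σ) (t : Tm σ) (a : ℕ) :
      FreshM a Γ → FreshM a Δ → a ∉ F.pars → a ∉ t.pars →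
      DerS σ P ((F.inst0 (.par a)) ::ₘ (Fml.ext (.par a)) ::ₘ Γ) Δ →
      DerS σ P ((Fml.ext t) ::ₘ (Fml.iq F (Fml.eq (.bvar 0) (t.lift 0))) ::ₘ Γ) Δ

/-! ### Simultaneous substitution of terms for parameters -/

namespace Tm

variable {σ : Sig}

/-- Simultaneous substitution of terms for parameters. -/
def sub (θ : ℕ → Tm σ) : Tm σ → Tm σ
  | par a => θ a
  | const c => const c
  | bvar n => bvar n
  | func f ts => func f fun i => (ts i).sub θ

theorem sub_par (t : Tm σ) : t.sub par = t := by
  induction t <;> simp_all [sub]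

theorem lift_lift_zero (k : ℕ) (t : Tm σ) :
    (t.lift 0).lift (k + 1) = (t.lift k).lift 0 := by
  induction t with
  | bvar n => by_cases h : n < k <;> simp [lift, h]
  | _ => simp_all [lift]

theorem sub_lift (k : ℕ) (θ : ℕ → Tm σ) (t : Tm σ) :
    (t.lift k).sub (fun a => (θ a).lift k) = (t.sub θ).lift k := by
  induction t with
  | bvar n => by_cases h : n < k <;> simp [lift, sub, h]
  | _ => simp_all [lift, sub]

theorem inst_lift (k : ℕ) (u t : Tm σ) : inst k u (t.lift k) = t := by
  induction t with
  | bvar n =>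
    by_cases h : n < k
    · have h1 : n ≠ k := by omega
      have h2 : ¬ k < n := by omega
      simp [lift, inst, h, h1, h2]
    · have h1 : n + 1 ≠ k := by omega
      have h2 : k < n + 1 := by omega
      simp [lift, inst, h, h1, h2]
  | _ => simp_all [lift, inst]

theorem sub_inst (k : ℕ) (u : Tm σ) (θ : ℕ → Tm σ) (t : Tm σ) :
    (inst k u t).sub θ = inst k (u.sub θ) (t.sub fun a => (θ a).lift k) := by
  induction t with
  | par a => simp [inst, sub, inst_lift]
  | bvar n =>
    simp only [inst, sub]
    split_ifs <;> simp [sub]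
  | _ => simp_all [inst, sub]

theorem sub_congr {θ θ' : ℕ → Tm σ} {t : Tm σ} (h : ∀ a ∈ t.pars, θ a = θ' a) :
    t.sub θ = t.sub θ' := by
  induction t with
  | func f ts ih =>
    simp only [sub, func.injEq, heq_eq_eq, true_and]
    funext i
    exact ih i fun a ha => h a (Set.mem_iUnion.2 ⟨i, ha⟩)
  | _ => simp_all [sub, pars]

theorem pars_finite (t : Tm σ) : t.pars.Finite := by
  induction t with
  | func f ts ih => exact Set.finite_iUnion ih
  | _ => simp [pars]

end Tm

namespace Fml

variable {σ : Sig}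

/-- Capture-avoiding simultaneous substitution of terms for parameters. -/
def sub (θ : ℕ → Tm σ) : Fml σ → Fml σ
  | atom p ts => atom p fun i => (ts i).sub θ
  | eq t s => eq (t.sub θ) (s.sub θ)
  | ext t => ext (t.sub θ)
  | neg A => neg (A.sub θ)
  | conj A B => conj (A.sub θ) (B.sub θ)
  | disj A B => disj (A.sub θ) (B.sub θ)
  | imp A B => imp (A.sub θ) (B.sub θ)
  | all A => all (A.sub fun a => (θ a).lift 0)
  | ex A => ex (A.sub fun a => (θ a).lift 0)
  | iq F G => iq (F.sub fun a => (θ a).lift 0) (G.sub fun a => (θ a).lift 0)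

theorem sub_par (A : Fml σ) : A.sub Tm.par = A := by
  induction A <;> simp_all [sub, Tm.sub_par, Tm.lift]

theorem sub_inst (A : Fml σ) (k : ℕ) (u : Tm σ) (θ : ℕ → Tm σ) :
    (A.inst k u).sub θ = (A.sub fun a => (θ a).lift k).inst k (u.sub θ) := by
  induction A generalizing k u θ <;>
    simp_all [sub, inst, Tm.sub_inst, Tm.sub_lift, Tm.lift_lift_zero]

theorem sub_inst0 (A : Fml σ) (u : Tm σ) (θ : ℕ → Tm σ) :
    (A.inst0 u).sub θ = (A.sub fun a => (θ a).lift 0).inst0 (u.sub θ) :=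
  sub_inst A 0 u θ

theorem sub_congr {A : Fml σ} {θ θ' : ℕ → Tm σ} (h : ∀ a ∈ A.pars, θ a = θ' a) :
    A.sub θ = A.sub θ' := by
  induction A generalizing θ θ' with
  | atom p ts =>
    simp only [sub, atom.injEq, heq_eq_eq, true_and]
    funext i
    exact Tm.sub_congr fun a ha => h a (Set.mem_iUnion.2 ⟨i, ha⟩)
  | eq t s =>
    rw [sub, sub, Tm.sub_congr fun a ha => h a (Or.inl ha),
      Tm.sub_congr fun a ha => h a (Or.inr ha)]
  | ext t => rw [sub, sub, Tm.sub_congr h]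
  | neg A ih => rw [sub, sub, ih h]
  | conj A B ihA ihB | disj A B ihA ihB | imp A B ihA ihB =>
    rw [sub, sub, ihA fun a ha => h a (Or.inl ha), ihB fun a ha => h a (Or.inr ha)]
  | all A ih | ex A ih => rw [sub, sub, ih fun a ha => congrArg _ (h a ha)]
  | iq F G ihF ihG =>
    rw [sub, sub, ihF fun a ha => congrArg _ (h a (Or.inl ha)),
      ihG fun a ha => congrArg _ (h a (Or.inr ha))]

theorem pars_finite (A : Fml σ) : A.pars.Finite := by
  induction A with
  | atom p ts => exact Set.finite_iUnion fun i => (ts i).pars_finite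
  | eq t s => exact t.pars_finite.union s.pars_finite
  | ext t => exact t.pars_finite
  | neg A ih | all A ih | ex A ih => exact ih
  | conj A B ihA ihB | disj A B ihA ihB | imp A B ihA ihB | iq A B ihA ihB => exact ihA.union ihB

theorem Atomic.sub {A : Fml σ} (h : A.Atomic) (θ : ℕ → Tm σ) : (A.sub θ).Atomic := by
  cases A <;> simp_all [Atomic, Fml.sub]

theorem deg_inst (A : Fml σ) (k : ℕ) (u : Tm σ) : (A.inst k u).deg = A.deg := by
  induction A generalizing k u <;> simp_all [deg, inst]

theorem deg_inst0 (A : Fml σ) (u : Tm σ) : (A.inst0 u).deg = A.deg := deg_inst A 0 u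

end Fml

/-- Extending the substitution by `a ↦ t` and then substituting for `a` in an instance. -/
theorem Fml.sub_update_inst0 {σ : Sig} {A : Fml σ} {a : ℕ} (ha : a ∉ A.pars) (θ : ℕ → Tm σ)
    (t : Tm σ) :
    (A.inst0 (.par a)).sub (Function.update θ a t)
      = (A.sub fun b => (θ b).lift 0).inst0 t := by
  rw [Fml.sub_inst0]
  congr 1
  · refine Fml.sub_congr fun b hb => ?_
    rw [Function.update_of_ne (fun (h : _ = a) => ha (h ▸ hb))]
  · simp [Tm.sub]

theorem Tm.sub_update {σ : Sig} {s : Tm σ} {a : ℕ} (ha : a ∉ s.pars) (θ : ℕ → Tm σ) (t : Tm σ) :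
    s.sub (Function.update θ a t) = s.sub θ :=
  Tm.sub_congr fun _ hb => Function.update_of_ne (fun (h : _ = a) => ha (h ▸ hb)) _ _

theorem FreshM.map_sub_update {σ : Sig} {Γ : Multiset (Fml σ)} {a : ℕ} (ha : FreshM a Γ)
    (θ : ℕ → Tm σ) (t : Tm σ) :
    Γ.map (Fml.sub (Function.update θ a t)) = Γ.map (Fml.sub θ) :=
  Multiset.map_congr rfl fun B hB => Fml.sub_congr fun _ hb =>
    Function.update_of_ne (fun (h : _ = a) => ha B hB (h ▸ hb)) _ _

/-- Some parameter avoids all the given formulas. -/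
theorem exists_freshM {σ : Sig} (Γ : Multiset (Fml σ)) : ∃ a, FreshM a Γ := by
  have h : {a | ∃ B ∈ Γ, a ∈ B.pars}.Finite := by
    induction Γ using Multiset.induction with
    | empty => simp
    | cons A Γ ih =>
      refine (A.pars_finite.union ih).subset ?_
      rintro a ⟨B, hB, ha⟩
      rcases Multiset.mem_cons.1 hB with rfl | hB
      · exact Or.inl ha
      · exact Or.inr ⟨B, hB, ha⟩
  obtain ⟨a, ha⟩ := h.exists_notMem
  exact ⟨a, fun B hB hab => ha ⟨B, hB, hab⟩⟩

theorem FreshM.of_add {σ : Sig} {Γ Δ : Multiset (Fml σ)} {a : ℕ}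
    (h : FreshM a (Γ + Δ)) : FreshM a Γ ∧ FreshM a Δ :=
  ⟨fun B hB => h B (Multiset.mem_add.2 (.inl hB)), fun B hB => h B (Multiset.mem_add.2 (.inr hB))⟩

/-! ### A cut-free calculus with retained principal formulas -/

/-- A cumulative variant of the cut-free calculus: principal formulas are kept in the
premises, and eigenvariable premises are required for all terms. -/
inductive Cumul (σ : Sig) : Multiset (Fml σ) → Multiset (Fml σ) → Prop
  | ax {Γ Δ : Multiset (Fml σ)} (A : Fml σ) : A ∈ Γ → A ∈ Δ → Cumul σ Γ Δ
  | lneg {Γ Δ : Multiset (Fml σ)} (A : Fml σ) : A.neg ∈ Γ → Cumul σ Γ (A ::ₘ Δ) → Cumul σ Γ Δ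
  | rneg {Γ Δ : Multiset (Fml σ)} (A : Fml σ) : A.neg ∈ Δ → Cumul σ (A ::ₘ Γ) Δ → Cumul σ Γ Δ
  | land {Γ Δ : Multiset (Fml σ)} (A B : Fml σ) : A.conj B ∈ Γ →
      Cumul σ (A ::ₘ B ::ₘ Γ) Δ → Cumul σ Γ Δ
  | rand {Γ Δ : Multiset (Fml σ)} (A B : Fml σ) : A.conj B ∈ Δ →
      Cumul σ Γ (A ::ₘ Δ) → Cumul σ Γ (B ::ₘ Δ) → Cumul σ Γ Δ
  | lor {Γ Δ : Multiset (Fml σ)} (A B : Fml σ) : A.disj B ∈ Γ →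
      Cumul σ (A ::ₘ Γ) Δ → Cumul σ (B ::ₘ Γ) Δ → Cumul σ Γ Δ
  | ror {Γ Δ : Multiset (Fml σ)} (A B : Fml σ) : A.disj B ∈ Δ →
      Cumul σ Γ (A ::ₘ B ::ₘ Δ) → Cumul σ Γ Δ
  | limp {Γ Δ : Multiset (Fml σ)} (A B : Fml σ) : A.imp B ∈ Γ →
      Cumul σ Γ (A ::ₘ Δ) → Cumul σ (B ::ₘ Γ) Δ → Cumul σ Γ Δ
  | rimp {Γ Δ : Multiset (Fml σ)} (A B : Fml σ) : A.imp B ∈ Δ →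
      Cumul σ (A ::ₘ Γ) (B ::ₘ Δ) → Cumul σ Γ Δ
  | lall {Γ Δ : Multiset (Fml σ)} (A : Fml σ) (t : Tm σ) : A.all ∈ Γ → Fml.ext t ∈ Γ →
      Cumul σ (A.inst0 t ::ₘ Γ) Δ → Cumul σ Γ Δ
  | rall {Γ Δ : Multiset (Fml σ)} (A : Fml σ) : A.all ∈ Δ →
      (∀ t, Cumul σ (Fml.ext t ::ₘ Γ) (A.inst0 t ::ₘ Δ)) → Cumul σ Γ Δ
  | lex {Γ Δ : Multiset (Fml σ)} (A : Fml σ) : A.ex ∈ Γ →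
      (∀ t, Cumul σ (Fml.ext t ::ₘ A.inst0 t ::ₘ Γ) Δ) → Cumul σ Γ Δ
  | rex {Γ Δ : Multiset (Fml σ)} (A : Fml σ) (t : Tm σ) : A.ex ∈ Δ → Fml.ext t ∈ Γ →
      Cumul σ Γ (A.inst0 t ::ₘ Δ) → Cumul σ Γ Δ
  | eqI {Γ Δ : Multiset (Fml σ)} (A : Fml σ) (t₁ t₂ : Tm σ) : A.Atomic →
      Fml.eq t₁ t₂ ∈ Γ → A.inst0 t₁ ∈ Γ → Cumul σ (A.inst0 t₂ ::ₘ Γ) Δ → Cumul σ Γ Δ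
  | eqE {Γ Δ : Multiset (Fml σ)} (t : Tm σ) : Cumul σ (Fml.eq t t ::ₘ Γ) Δ → Cumul σ Γ Δ
  | ri {Γ Δ : Multiset (Fml σ)} (F G : Fml σ) (t : Tm σ) : F.iq G ∈ Δ → Fml.ext t ∈ Γ →
      Cumul σ Γ (F.inst0 t ::ₘ Δ) → Cumul σ Γ (G.inst0 t ::ₘ Δ) →
      (∀ s, Cumul σ (Fml.ext s ::ₘ F.inst0 s ::ₘ Γ) (Fml.eq s t ::ₘ Δ)) → Cumul σ Γ Δ
  | li1 {Γ Δ : Multiset (Fml σ)} (F G : Fml σ) (t : Tm σ) : F.iq G ∈ Γ → Fml.ext t ∈ Γ →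
      Cumul σ Γ (F.inst0 t ::ₘ Δ) →
      (∀ s, Cumul σ (F.inst0 s ::ₘ Fml.ext s ::ₘ Γ) (Fml.eq s t ::ₘ Δ)) →
      (∀ s, Cumul σ (F.inst0 s ::ₘ G.inst0 s ::ₘ Fml.ext s ::ₘ Γ) Δ) → Cumul σ Γ Δ
  | li2 {Γ Δ : Multiset (Fml σ)} (F : Fml σ) (t₁ t₂ : Tm σ) : F.iq Fml.exG ∈ Γ →
      Fml.ext t₁ ∈ Γ → Fml.ext t₂ ∈ Γ →
      Cumul σ Γ (F.inst0 t₁ ::ₘ Δ) → Cumul σ Γ (F.inst0 t₂ ::ₘ Δ) →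
      Cumul σ (Fml.eq t₁ t₂ ::ₘ Γ) Δ → Cumul σ Γ Δ
  | li3 {Γ Δ : Multiset (Fml σ)} (F : Fml σ) : F.iq Fml.exG ∈ Γ →
      (∀ s, Cumul σ (F.inst0 s ::ₘ Fml.ext s ::ₘ Γ) Δ) → Cumul σ Γ Δ
  | li4 {Γ Δ : Multiset (Fml σ)} (F : Fml σ) (t₁ t₂ : Tm σ) :
      F.iq (Fml.eq (.bvar 0) (t₂.lift 0)) ∈ Γ → Fml.ext t₁ ∈ Γ → Fml.ext t₂ ∈ Γ →
      Cumul σ Γ (F.inst0 t₁ ::ₘ Δ) → Cumul σ (Fml.eq t₁ t₂ ::ₘ Γ) Δ → Cumul σ Γ Δ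
  | li5 {Γ Δ : Multiset (Fml σ)} (F : Fml σ) (t : Tm σ) :
      F.iq (Fml.eq (.bvar 0) (t.lift 0)) ∈ Γ → Fml.ext t ∈ Γ →
      (∀ s, Cumul σ (F.inst0 s ::ₘ Fml.ext s ::ₘ Γ) Δ) → Cumul σ Γ Δ

namespace DerS

variable {σ : Sig} {P : Fml σ → Prop} {Γ Δ : Multiset (Fml σ)} {A : Fml σ}

theorem contract_left (hA : A ∈ Γ) (h : DerS σ P (A ::ₘ Γ) Δ) : DerS σ P Γ Δ := by
  obtain ⟨Γ, rfl⟩ := Multiset.exists_cons_of_mem hA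
  exact lc A h

theorem contract_right (hA : A ∈ Δ) (h : DerS σ P Γ (A ::ₘ Δ)) : DerS σ P Γ Δ := by
  obtain ⟨Δ, rfl⟩ := Multiset.exists_cons_of_mem hA
  exact rc A h

theorem weaken_left (Γ' : Multiset (Fml σ)) (h : DerS σ P Γ Δ) : DerS σ P (Γ' + Γ) Δ := by
  induction Γ' using Multiset.induction with
  | empty => simpa using h
  | cons A Γ' ih => simpa using lw A ih

theorem weaken_right (Δ' : Multiset (Fml σ)) (h : DerS σ P Γ Δ) : DerS σ P Γ (Δ' + Δ) := by
  induction Δ' using Multiset.induction with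
  | empty => simpa using h
  | cons A Δ' ih => simpa using rw A ih

end DerS

namespace Cumul

variable {σ : Sig}

theorem mono {Γ Δ : Multiset (Fml σ)} (h : Cumul σ Γ Δ) :
    ∀ {Γ' Δ' : Multiset (Fml σ)}, Γ ⊆ Γ' → Δ ⊆ Δ' → Cumul σ Γ' Δ' := by
  have c : ∀ {A : Fml σ} {Γ Γ'}, Γ ⊆ Γ' → A ::ₘ Γ ⊆ A ::ₘ Γ' := Multiset.cons_subset_cons
  induction h with
  | ax A h₁ h₂ => intro _ _ l r; exact ax A (l h₁) (r h₂)
  | lneg A h _ i => intro _ _ l r; exact lneg A (l h) (i l (c r))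
  | rneg A h _ i => intro _ _ l r; exact rneg A (r h) (i (c l) r)
  | land A B h _ i => intro _ _ l r; exact land A B (l h) (i (c (c l)) r)
  | rand A B h _ _ i j => intro _ _ l r; exact rand A B (r h) (i l (c r)) (j l (c r))
  | lor A B h _ _ i j => intro _ _ l r; exact lor A B (l h) (i (c l) r) (j (c l) r)
  | ror A B h _ i => intro _ _ l r; exact ror A B (r h) (i l (c (c r)))
  | limp A B h _ _ i j => intro _ _ l r; exact limp A B (l h) (i l (c r)) (j (c l) r)
  | rimp A B h _ i => intro _ _ l r; exact rimp A B (r h) (i (c l) (c r))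
  | lall A t h e _ i => intro _ _ l r; exact lall A t (l h) (l e) (i (c l) r)
  | rall A h _ i => intro _ _ l r; exact rall A (r h) fun t => i t (c l) (c r)
  | lex A h _ i => intro _ _ l r; exact lex A (l h) fun t => i t (c (c l)) r
  | rex A t h e _ i => intro _ _ l r; exact rex A t (r h) (l e) (i l (c r))
  | eqI A t₁ t₂ hA h e _ i => intro _ _ l r; exact eqI A t₁ t₂ hA (l h) (l e) (i (c l) r)
  | eqE t _ i => intro _ _ l r; exact eqE t (i (c l) r)
  | ri F G t h e _ _ _ i j k =>
    intro _ _ l r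
    exact ri F G t (r h) (l e) (i l (c r)) (j l (c r)) fun s => k s (c (c l)) (c r)
  | li1 F G t h e _ _ _ i j k =>
    intro _ _ l r
    exact li1 F G t (l h) (l e) (i l (c r)) (fun s => j s (c (c l)) (c r))
      fun s => k s (c (c (c l))) r
  | li2 F t₁ t₂ h e₁ e₂ _ _ _ i j k =>
    intro _ _ l r
    exact li2 F t₁ t₂ (l h) (l e₁) (l e₂) (i l (c r)) (j l (c r)) (k (c l) r)
  | li3 F h _ i => intro _ _ l r; exact li3 F (l h) fun s => i s (c (c l)) r
  | li4 F t₁ t₂ h e₁ e₂ _ _ i j =>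
    intro _ _ l r
    exact li4 F t₁ t₂ (l h) (l e₁) (l e₂) (i l (c r)) (j (c l) r)
  | li5 F t h e _ i => intro _ _ l r; exact li5 F t (l h) (l e) fun s => i s (c (c l)) r

/-- The cumulative calculus is contained in the cut-free fragment of `DerS`. -/
theorem toDerS {P : Fml σ → Prop} {Γ Δ : Multiset (Fml σ)} (h : Cumul σ Γ Δ) :
    DerS σ P Γ Δ := by
  induction h with
  | @ax Γ Δ A h₁ h₂ =>
    obtain ⟨Γ, rfl⟩ := Multiset.exists_cons_of_mem h₁
    obtain ⟨Δ, rfl⟩ := Multiset.exists_cons_of_mem h₂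
    rw [← Multiset.singleton_add, ← Multiset.singleton_add, add_comm, add_comm {A} Δ]
    exact ((DerS.ax A).weaken_left Γ).weaken_right Δ
  | lneg A h _ i => exact (DerS.lneg A i).contract_left h
  | rneg A h _ i => exact (DerS.rneg A i).contract_right h
  | land A B h _ i => exact (DerS.land A B i).contract_left h
  | rand A B h _ _ i j => exact (DerS.rand A B i j).contract_right h
  | lor A B h _ _ i j => exact (DerS.lor A B i j).contract_left h
  | ror A B h _ i => exact (DerS.ror A B i).contract_right h
  | limp A B h _ _ i j => exact (DerS.limp A B i j).contract_left h
  | rimp A B h _ i => exact (DerS.rimp A B i).contract_right h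
  | lall A t h e _ i =>
    exact ((DerS.lall A t i).contract_left (by simp [e])).contract_left h
  | @rall Γ Δ A h _ i =>
    obtain ⟨a, ha⟩ := exists_freshM (Γ + Δ)
    obtain ⟨hΓ, hΔ⟩ := ha.of_add
    exact (DerS.rall A a hΓ hΔ (hΔ A.all h) (i _)).contract_right h
  | @lex Γ Δ A h _ i =>
    obtain ⟨a, ha⟩ := exists_freshM (Γ + Δ)
    obtain ⟨hΓ, hΔ⟩ := ha.of_add
    exact (DerS.lex A a hΓ hΔ (hΓ A.ex h) (i _)).contract_left h
  | rex A t h e _ i => exact ((DerS.rex A t i).contract_right h).contract_left e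
  | eqI A t₁ t₂ hA h e _ i =>
    refine (DerS.contract_left (Multiset.mem_cons_of_mem e) ?_).contract_left h
    rw [Multiset.cons_swap]
    exact DerS.eqI A t₁ t₂ hA i
  | eqE t _ i => exact DerS.eqE t i
  | @ri Γ Δ F G t h e _ _ _ i j k =>
    obtain ⟨a, ha⟩ := exists_freshM (Γ + Δ)
    obtain ⟨hΓ, hΔ⟩ := ha.of_add
    exact ((DerS.riS F G t a hΓ hΔ (fun m => hΔ _ h (.inl m)) (fun m => hΔ _ h (.inr m))
      (hΓ _ e) i j (k _)).contract_right h).contract_left e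
  | @li1 Γ Δ F G t h e _ _ _ i j k =>
    obtain ⟨a, ha⟩ := exists_freshM (Γ + Δ)
    obtain ⟨hΓ, hΔ⟩ := ha.of_add
    have hF : a ∉ F.pars := fun m => hΓ _ h (.inl m)
    have hG : a ∉ G.pars := fun m => hΓ _ h (.inr m)
    exact ((DerS.li1S F G t a a hΓ hΔ hF hG (hΓ _ e) hΓ hΔ hF hG (hΓ _ e) i (j _)
      (k _)).contract_left (by simp [e])).contract_left h
  | li2 F t₁ t₂ h e₁ e₂ _ _ _ i j k =>
    exact (((DerS.li2SI F t₁ t₂ i j k).contract_left (by simp [e₁])).contract_left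
      (by simp [e₂])).contract_left h
  | @li3 Γ Δ F h _ i =>
    obtain ⟨a, ha⟩ := exists_freshM (Γ + Δ)
    obtain ⟨hΓ, hΔ⟩ := ha.of_add
    exact (DerS.li3 F a hΓ hΔ (fun m => hΓ _ h (.inl m)) (i _)).contract_left h
  | li4 F t₁ t₂ h e₁ e₂ _ _ i j =>
    exact (((DerS.li4SI F t₁ t₂ i j).contract_left (by simp [e₁])).contract_left
      (by simp [e₂])).contract_left h
  | @li5 Γ Δ F t h e _ i =>
    obtain ⟨a, ha⟩ := exists_freshM (Γ + Δ)
    obtain ⟨hΓ, hΔ⟩ := ha.of_add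
    exact ((DerS.li5S F t a hΓ hΔ (fun m => hΓ _ h (.inl m)) (hΓ _ e) (i _)).contract_left
      (by simp [e])).contract_left h

/-! ### Admissibility of cut -/

/-- The premises of a right rule with principal formula `A`. -/
def RightPremises (A : Fml σ) (Γ Δ : Multiset (Fml σ)) : Prop :=
  match A with
  | .atom _ _ | .eq _ _ | .ext _ => False
  | .neg A => Cumul σ (A ::ₘ Γ) Δ
  | .conj A B => Cumul σ Γ (A ::ₘ Δ) ∧ Cumul σ Γ (B ::ₘ Δ)
  | .disj A B => Cumul σ Γ (A ::ₘ B ::ₘ Δ)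
  | .imp A B => Cumul σ (A ::ₘ Γ) (B ::ₘ Δ)
  | .all A => ∀ t, Cumul σ (Fml.ext t ::ₘ Γ) (A.inst0 t ::ₘ Δ)
  | .ex A => ∃ t, Fml.ext t ∈ Γ ∧ Cumul σ Γ (A.inst0 t ::ₘ Δ)
  | .iq F G => ∃ t, Fml.ext t ∈ Γ ∧ Cumul σ Γ (F.inst0 t ::ₘ Δ) ∧ Cumul σ Γ (G.inst0 t ::ₘ Δ) ∧
      ∀ s, Cumul σ (Fml.ext s ::ₘ F.inst0 s ::ₘ Γ) (Fml.eq s t ::ₘ Δ)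

/-- The premises of a left rule with the compound principal formula `A`. -/
def LeftPremises (A : Fml σ) (Γ Δ : Multiset (Fml σ)) : Prop :=
  match A with
  | .atom _ _ | .eq _ _ | .ext _ => True
  | .neg A => Cumul σ Γ (A ::ₘ Δ)
  | .conj A B => Cumul σ (A ::ₘ B ::ₘ Γ) Δ
  | .disj A B => Cumul σ (A ::ₘ Γ) Δ ∧ Cumul σ (B ::ₘ Γ) Δ
  | .imp A B => Cumul σ Γ (A ::ₘ Δ) ∧ Cumul σ (B ::ₘ Γ) Δ
  | .all A => ∃ t, Fml.ext t ∈ Γ ∧ Cumul σ (A.inst0 t ::ₘ Γ) Δ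
  | .ex A => ∀ t, Cumul σ (Fml.ext t ::ₘ A.inst0 t ::ₘ Γ) Δ
  | .iq F G =>
      (∃ t, Fml.ext t ∈ Γ ∧ Cumul σ Γ (F.inst0 t ::ₘ Δ) ∧
        (∀ s, Cumul σ (F.inst0 s ::ₘ Fml.ext s ::ₘ Γ) (Fml.eq s t ::ₘ Δ)) ∧
        ∀ s, Cumul σ (F.inst0 s ::ₘ G.inst0 s ::ₘ Fml.ext s ::ₘ Γ) Δ) ∨
      (G = Fml.exG ∧ ∃ t₁ t₂, Fml.ext t₁ ∈ Γ ∧ Fml.ext t₂ ∈ Γ ∧ Cumul σ Γ (F.inst0 t₁ ::ₘ Δ) ∧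
        Cumul σ Γ (F.inst0 t₂ ::ₘ Δ) ∧ Cumul σ (Fml.eq t₁ t₂ ::ₘ Γ) Δ) ∨
      (G = Fml.exG ∧ ∀ s, Cumul σ (F.inst0 s ::ₘ Fml.ext s ::ₘ Γ) Δ) ∨
      (∃ t₁ t₂, G = Fml.eq (.bvar 0) (t₂.lift 0) ∧ Fml.ext t₁ ∈ Γ ∧ Fml.ext t₂ ∈ Γ ∧
        Cumul σ Γ (F.inst0 t₁ ::ₘ Δ) ∧ Cumul σ (Fml.eq t₁ t₂ ::ₘ Γ) Δ) ∨
      (∃ t, G = Fml.eq (.bvar 0) (t.lift 0) ∧ Fml.ext t ∈ Γ ∧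
        ∀ s, Cumul σ (F.inst0 s ::ₘ Fml.ext s ::ₘ Γ) Δ)

theorem LeftPremises.mono {A : Fml σ} {Γ Δ Γ' Δ' : Multiset (Fml σ)} (h : LeftPremises A Γ Δ)
    (l : Γ ⊆ Γ') (r : Δ ⊆ Δ') : LeftPremises A Γ' Δ' := by
  have c : ∀ {A : Fml σ} {Γ Γ'}, Γ ⊆ Γ' → A ::ₘ Γ ⊆ A ::ₘ Γ' := Multiset.cons_subset_cons
  cases A with
  | atom | eq | ext => trivial
  | neg A => exact Cumul.mono h l (c r)
  | conj A B => exact Cumul.mono h (c (c l)) r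
  | disj A B => exact ⟨h.1.mono (c l) r, h.2.mono (c l) r⟩
  | imp A B => exact ⟨h.1.mono l (c r), h.2.mono (c l) r⟩
  | all A =>
    obtain ⟨t, e, h⟩ := h
    exact ⟨t, l e, h.mono (c l) r⟩
  | ex A => exact fun t => (h t).mono (c (c l)) r
  | iq F G =>
    rcases h with ⟨t, e, i, j, k⟩ | ⟨rfl, t₁, t₂, e₁, e₂, i, j, k⟩ | ⟨rfl, i⟩ |
      ⟨t₁, t₂, rfl, e₁, e₂, i, j⟩ | ⟨t, rfl, e, i⟩
    · exact .inl ⟨t, l e, i.mono l (c r), fun s => (j s).mono (c (c l)) (c r),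
        fun s => (k s).mono (c (c (c l))) r⟩
    · exact .inr (.inl ⟨rfl, t₁, t₂, l e₁, l e₂, i.mono l (c r), j.mono l (c r), k.mono (c l) r⟩)
    · exact .inr (.inr (.inl ⟨rfl, fun s => (i s).mono (c (c l)) r⟩))
    · exact .inr (.inr (.inr (.inl ⟨t₁, t₂, rfl, l e₁, l e₂, i.mono l (c r), j.mono (c l) r⟩)))
    · exact .inr (.inr (.inr (.inr ⟨t, rfl, l e, fun s => (i s).mono (c (c l)) r⟩)))

theorem of_leftPremises {A : Fml σ} {Γ Δ : Multiset (Fml σ)} (hA : ¬ A.Atomic) (m : A ∈ Γ)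
    (h : LeftPremises A Γ Δ) : Cumul σ Γ Δ := by
  cases A with
  | atom | eq | ext => exact absurd trivial hA
  | neg A => exact lneg A m h
  | conj A B => exact land A B m h
  | disj A B => exact lor A B m h.1 h.2
  | imp A B => exact limp A B m h.1 h.2
  | all A =>
    obtain ⟨t, e, h⟩ := h
    exact lall A t m e h
  | ex A => exact lex A m h
  | iq F G =>
    rcases h with ⟨t, e, i, j, k⟩ | ⟨rfl, t₁, t₂, e₁, e₂, i, j, k⟩ | ⟨rfl, i⟩ |
      ⟨t₁, t₂, rfl, e₁, e₂, i, j⟩ | ⟨t, rfl, e, i⟩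
    · exact li1 F G t m e i j k
    · exact li2 F t₁ t₂ m e₁ e₂ i j k
    · exact li3 F m i
    · exact li4 F t₁ t₂ m e₁ e₂ i j
    · exact li5 F t m e i

/-- `Absorbs Q Γ Δ`: every extension of `Γ ⇒ Δ` satisfying `Q` is derivable. -/
def Absorbs (Q : Multiset (Fml σ) → Multiset (Fml σ) → Prop) (Γ Δ : Multiset (Fml σ)) : Prop :=
  ∀ ⦃Γ' Δ'⦄, Γ ⊆ Γ' → Δ ⊆ Δ' → Q Γ' Δ' → Cumul σ Γ' Δ'

namespace Absorbs

variable {Q : Multiset (Fml σ) → Multiset (Fml σ) → Prop} {Γ Δ : Multiset (Fml σ)}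

theorem left (h : Absorbs Q Γ Δ) (A : Fml σ) : Absorbs Q (A ::ₘ Γ) Δ :=
  fun _ _ l r => h (fun _ m => l (Multiset.mem_cons_of_mem m)) r

theorem right (h : Absorbs Q Γ Δ) (A : Fml σ) : Absorbs Q Γ (A ::ₘ Δ) :=
  fun _ _ l r => h l (fun _ m => r (Multiset.mem_cons_of_mem m))

theorem self (h : Absorbs Q Γ Δ) (q : Q Γ Δ) : Cumul σ Γ Δ :=
  h (fun _ m => m) (fun _ m => m) q

end Absorbs

theorem cons_subset_swap {A B : Fml σ} {Γ Γ' : Multiset (Fml σ)} (h : Γ ⊆ A ::ₘ Γ') :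
    B ::ₘ Γ ⊆ A ::ₘ B ::ₘ Γ' := by
  rw [Multiset.cons_swap]
  exact Multiset.cons_subset_cons h

/-- A succedent formula can be removed if its left occurrences and the premises of its right
rules suffice for derivability. -/
theorem remove_right {A : Fml σ} {Γ₀ Δ₀ : Multiset (Fml σ)} (h : Cumul σ Γ₀ Δ₀) :
    ∀ {Γ Δ : Multiset (Fml σ)}, Γ₀ ⊆ Γ → Δ₀ ⊆ A ::ₘ Δ →
      Absorbs (fun Γ Δ => A ∈ Γ ∨ RightPremises A Γ Δ) Γ Δ → Cumul σ Γ Δ := by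
  have c : ∀ {A : Fml σ} {Γ Γ'}, Γ ⊆ Γ' → A ::ₘ Γ ⊆ A ::ₘ Γ' := Multiset.cons_subset_cons
  have w : ∀ {B : Fml σ} {Γ Γ'}, Γ ⊆ A ::ₘ Γ' → B ::ₘ Γ ⊆ A ::ₘ B ::ₘ Γ' := cons_subset_swap
  induction h with
  | ax B h₁ h₂ =>
    intro _ _ l r H
    rcases Multiset.mem_cons.1 (r h₂) with rfl | h₂
    · exact H.self (.inl (l h₁))
    · exact ax B (l h₁) h₂
  | lneg B h _ i => intro _ _ l r H; exact lneg B (l h) (i l (w r) (H.right _))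
  | rneg B h _ i =>
    intro _ _ l r H
    replace i := i (c l) r (H.left _)
    rcases Multiset.mem_cons.1 (r h) with rfl | h
    · exact H.self (.inr i)
    · exact rneg B h i
  | land B C h _ i =>
    intro _ _ l r H; exact land B C (l h) (i (c (c l)) r ((H.left _).left _))
  | rand B C h _ _ i j =>
    intro _ _ l r H
    replace i := i l (w r) (H.right _)
    replace j := j l (w r) (H.right _)
    rcases Multiset.mem_cons.1 (r h) with rfl | h
    · exact H.self (.inr ⟨i, j⟩)
    · exact rand B C h i j
  | lor B C h _ _ i j =>
    intro _ _ l r H; exact lor B C (l h) (i (c l) r (H.left _)) (j (c l) r (H.left _))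
  | ror B C h _ i =>
    intro _ _ l r H
    replace i := i l (w (w r)) ((H.right _).right _)
    rcases Multiset.mem_cons.1 (r h) with rfl | h
    · exact H.self (.inr i)
    · exact ror B C h i
  | limp B C h _ _ i j =>
    intro _ _ l r H; exact limp B C (l h) (i l (w r) (H.right _)) (j (c l) r (H.left _))
  | rimp B C h _ i =>
    intro _ _ l r H
    replace i := i (c l) (w r) ((H.left _).right _)
    rcases Multiset.mem_cons.1 (r h) with rfl | h
    · exact H.self (.inr i)
    · exact rimp B C h i
  | lall B t h e _ i => intro _ _ l r H; exact lall B t (l h) (l e) (i (c l) r (H.left _))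
  | rall B h _ i =>
    intro _ _ l r H
    replace i := fun t => i t (c l) (w r) ((H.left _).right _)
    rcases Multiset.mem_cons.1 (r h) with rfl | h
    · exact H.self (.inr i)
    · exact rall B h i
  | lex B h _ i =>
    intro _ _ l r H; exact lex B (l h) fun t => i t (c (c l)) r ((H.left _).left _)
  | rex B t h e _ i =>
    intro _ _ l r H
    replace i := i l (w r) (H.right _)
    rcases Multiset.mem_cons.1 (r h) with rfl | h
    · exact H.self (.inr ⟨t, l e, i⟩)
    · exact rex B t h (l e) i
  | eqI B t₁ t₂ hB h e _ i =>
    intro _ _ l r H; exact eqI B t₁ t₂ hB (l h) (l e) (i (c l) r (H.left _))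
  | eqE t _ i => intro _ _ l r H; exact eqE t (i (c l) r (H.left _))
  | ri F G t h e _ _ _ i j k =>
    intro _ _ l r H
    replace i := i l (w r) (H.right _)
    replace j := j l (w r) (H.right _)
    replace k := fun s => k s (c (c l)) (w r) (((H.left _).left _).right _)
    rcases Multiset.mem_cons.1 (r h) with rfl | h
    · exact H.self (.inr ⟨t, l e, i, j, k⟩)
    · exact ri F G t h (l e) i j k
  | li1 F G t h e _ _ _ i j k =>
    intro _ _ l r H
    exact li1 F G t (l h) (l e) (i l (w r) (H.right _))
      (fun s => j s (c (c l)) (w r) (((H.left _).left _).right _))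
      fun s => k s (c (c (c l))) r (((H.left _).left _).left _)
  | li2 F t₁ t₂ h e₁ e₂ _ _ _ i j k =>
    intro _ _ l r H
    exact li2 F t₁ t₂ (l h) (l e₁) (l e₂) (i l (w r) (H.right _)) (j l (w r) (H.right _))
      (k (c l) r (H.left _))
  | li3 F h _ i =>
    intro _ _ l r H; exact li3 F (l h) fun s => i s (c (c l)) r ((H.left _).left _)
  | li4 F t₁ t₂ h e₁ e₂ _ _ i j =>
    intro _ _ l r H
    exact li4 F t₁ t₂ (l h) (l e₁) (l e₂) (i l (w r) (H.right _)) (j (c l) r (H.left _))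
  | li5 F t h e _ i =>
    intro _ _ l r H
    exact li5 F t (l h) (l e) fun s => i s (c (c l)) r ((H.left _).left _)

/-- An antecedent compound formula can be removed if its right occurrences and the premises of
its left rules suffice for derivability. -/
theorem remove_left {A : Fml σ} (hA : ¬ A.Atomic) {Γ₀ Δ₀ : Multiset (Fml σ)}
    (h : Cumul σ Γ₀ Δ₀) :
    ∀ {Γ Δ : Multiset (Fml σ)}, Γ₀ ⊆ A ::ₘ Γ → Δ₀ ⊆ Δ →
      Absorbs (fun Γ Δ => A ∈ Δ ∨ LeftPremises A Γ Δ) Γ Δ → Cumul σ Γ Δ := by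
  have c : ∀ {A : Fml σ} {Γ Γ'}, Γ ⊆ Γ' → A ::ₘ Γ ⊆ A ::ₘ Γ' := Multiset.cons_subset_cons
  have w : ∀ {B : Fml σ} {Γ Γ'}, Γ ⊆ A ::ₘ Γ' → B ::ₘ Γ ⊆ A ::ₘ B ::ₘ Γ' := cons_subset_swap
  have a : ∀ {B : Fml σ} {Γ}, B.Atomic → B ∈ A ::ₘ Γ → B ∈ Γ := fun hB m =>
    (Multiset.mem_cons.1 m).resolve_left fun e => hA (e ▸ hB)
  induction h with
  | ax B h₁ h₂ =>
    intro _ _ l r H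
    rcases Multiset.mem_cons.1 (l h₁) with rfl | h₁
    · exact H.self (.inl (r h₂))
    · exact ax B h₁ (r h₂)
  | lneg B h _ i =>
    intro _ _ l r H
    replace i := i l (c r) (H.right _)
    rcases Multiset.mem_cons.1 (l h) with rfl | h
    · exact H.self (.inr i)
    · exact lneg B h i
  | rneg B h _ i => intro _ _ l r H; exact rneg B (r h) (i (w l) r (H.left _))
  | land B C h _ i =>
    intro _ _ l r H
    replace i := i (w (w l)) r ((H.left _).left _)
    rcases Multiset.mem_cons.1 (l h) with rfl | h
    · exact H.self (.inr i)
    · exact land B C h i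
  | rand B C h _ _ i j =>
    intro _ _ l r H; exact rand B C (r h) (i l (c r) (H.right _)) (j l (c r) (H.right _))
  | lor B C h _ _ i j =>
    intro _ _ l r H
    replace i := i (w l) r (H.left _)
    replace j := j (w l) r (H.left _)
    rcases Multiset.mem_cons.1 (l h) with rfl | h
    · exact H.self (.inr ⟨i, j⟩)
    · exact lor B C h i j
  | ror B C h _ i =>
    intro _ _ l r H; exact ror B C (r h) (i l (c (c r)) ((H.right _).right _))
  | limp B C h _ _ i j =>
    intro _ _ l r H
    replace i := i l (c r) (H.right _)
    replace j := j (w l) r (H.left _)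
    rcases Multiset.mem_cons.1 (l h) with rfl | h
    · exact H.self (.inr ⟨i, j⟩)
    · exact limp B C h i j
  | rimp B C h _ i =>
    intro _ _ l r H; exact rimp B C (r h) (i (w l) (c r) ((H.left _).right _))
  | lall B t h e _ i =>
    intro _ _ l r H
    replace i := i (w l) r (H.left _)
    replace e := a (B := .ext t) trivial (l e)
    rcases Multiset.mem_cons.1 (l h) with rfl | h
    · exact H.self (.inr ⟨t, e, i⟩)
    · exact lall B t h e i
  | rall B h _ i =>
    intro _ _ l r H; exact rall B (r h) fun t => i t (w l) (c r) ((H.left _).right _)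
  | lex B h _ i =>
    intro _ _ l r H
    replace i := fun t => i t (w (w l)) r ((H.left _).left _)
    rcases Multiset.mem_cons.1 (l h) with rfl | h
    · exact H.self (.inr i)
    · exact lex B h i
  | rex B t h e _ i =>
    intro _ _ l r H; exact rex B t (r h) (a trivial (l e)) (i l (c r) (H.right _))
  | eqI B t₁ t₂ hB h e _ i =>
    intro _ _ l r H
    have hB' : (B.inst0 t₁).Atomic := by
      cases B <;> first | exact hB.elim | trivial
    exact eqI B t₁ t₂ hB (a trivial (l h)) (a hB' (l e)) (i (w l) r (H.left _))
  | eqE t _ i => intro _ _ l r H; exact eqE t (i (w l) r (H.left _))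
  | ri F G t h e _ _ _ i j k =>
    intro _ _ l r H
    exact ri F G t (r h) (a trivial (l e)) (i l (c r) (H.right _)) (j l (c r) (H.right _))
      fun s => k s (w (w l)) (c r) (((H.left _).left _).right _)
  | li1 F G t h e _ _ _ i j k =>
    intro _ _ l r H
    replace e := a (B := .ext t) trivial (l e)
    replace i := i l (c r) (H.right _)
    replace j := fun s => j s (w (w l)) (c r) (((H.left _).left _).right _)
    replace k := fun s => k s (w (w (w l))) r (((H.left _).left _).left _)
    rcases Multiset.mem_cons.1 (l h) with rfl | h
    · exact H.self (.inr (.inl ⟨t, e, i, j, k⟩))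
    · exact li1 F G t h e i j k
  | li2 F t₁ t₂ h e₁ e₂ _ _ _ i j k =>
    intro _ _ l r H
    replace e₁ := a (B := .ext t₁) trivial (l e₁)
    replace e₂ := a (B := .ext t₂) trivial (l e₂)
    replace i := i l (c r) (H.right _)
    replace j := j l (c r) (H.right _)
    replace k := k (w l) r (H.left _)
    rcases Multiset.mem_cons.1 (l h) with rfl | h
    · exact H.self (.inr (.inr (.inl ⟨rfl, t₁, t₂, e₁, e₂, i, j, k⟩)))
    · exact li2 F t₁ t₂ h e₁ e₂ i j k
  | li3 F h _ i =>
    intro _ _ l r H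
    replace i := fun s => i s (w (w l)) r ((H.left _).left _)
    rcases Multiset.mem_cons.1 (l h) with rfl | h
    · exact H.self (.inr (.inr (.inr (.inl ⟨rfl, i⟩))))
    · exact li3 F h i
  | li4 F t₁ t₂ h e₁ e₂ _ _ i j =>
    intro _ _ l r H
    replace e₁ := a (B := .ext t₁) trivial (l e₁)
    replace e₂ := a (B := .ext t₂) trivial (l e₂)
    replace i := i l (c r) (H.right _)
    replace j := j (w l) r (H.left _)
    rcases Multiset.mem_cons.1 (l h) with rfl | h
    · exact H.self (.inr (.inr (.inr (.inr (.inl ⟨t₁, t₂, rfl, e₁, e₂, i, j⟩)))))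
    · exact li4 F t₁ t₂ h e₁ e₂ i j
  | li5 F t h e _ i =>
    intro _ _ l r H
    replace e := a (B := .ext t) trivial (l e)
    replace i := fun s => i s (w (w l)) r ((H.left _).left _)
    rcases Multiset.mem_cons.1 (l h) with rfl | h
    · exact H.self (.inr (.inr (.inr (.inr (.inr ⟨t, rfl, e, i⟩)))))
    · exact li5 F t h e i

/-- Cut on the formula `A` with shared contexts is admissible. -/
def CutAdmissible (A : Fml σ) : Prop :=
  ∀ {Γ Δ : Multiset (Fml σ)}, Cumul σ Γ (A ::ₘ Δ) → Cumul σ (A ::ₘ Γ) Δ → Cumul σ Γ Δ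

theorem cutAdmissible_of_atomic {A : Fml σ} (hA : A.Atomic) : CutAdmissible A := by
  intro Γ Δ h₁ h₂
  refine remove_right h₁ (fun _ m => m) (fun _ m => m) fun Γ' Δ' l r q => ?_
  rcases q with m | q
  · exact h₂.mono (Multiset.cons_subset.2 ⟨m, l⟩) r
  · cases A <;> first | exact hA.elim | exact q.elim

theorem weaken_left {Γ Δ : Multiset (Fml σ)} (A : Fml σ) (h : Cumul σ Γ Δ) :
    Cumul σ (A ::ₘ Γ) Δ :=
  h.mono (Multiset.subset_cons _ _) fun _ m => m

theorem weaken_right {Γ Δ : Multiset (Fml σ)} (A : Fml σ) (h : Cumul σ Γ Δ) :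
    Cumul σ Γ (A ::ₘ Δ) :=
  h.mono (fun _ m => m) (Multiset.subset_cons _ _)

theorem contract_left {Γ Δ : Multiset (Fml σ)} {A : Fml σ} (m : A ∈ Γ)
    (h : Cumul σ (A ::ₘ Γ) Δ) : Cumul σ Γ Δ :=
  h.mono (Multiset.cons_subset.2 ⟨m, fun _ m => m⟩) fun _ m => m

theorem eq_symm {Γ Δ : Multiset (Fml σ)} {t s : Tm σ} (h : Cumul σ Γ (Fml.eq t s ::ₘ Δ)) :
    Cumul σ Γ (Fml.eq s t ::ₘ Δ) := by
  have e : ∀ u, (Fml.eq (.bvar 0) (t.lift 0)).inst0 u = Fml.eq u t := fun u => by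
    simp [Fml.inst0, Fml.inst, Tm.inst, Tm.inst_lift]
  refine cutAdmissible_of_atomic (A := Fml.eq t s) trivial
    (h.mono (fun _ m => m) (Multiset.cons_subset_cons (Multiset.subset_cons _ _))) (eqE t ?_)
  refine eqI (Fml.eq (.bvar 0) (t.lift 0)) t s trivial (by simp) (by simp [e]) ?_
  exact ax (Fml.eq s t) (by simp [e]) (by simp)

theorem eq_trans {Γ Δ : Multiset (Fml σ)} {t s u : Tm σ} (h₁ : Cumul σ Γ (Fml.eq t s ::ₘ Δ))
    (h₂ : Cumul σ Γ (Fml.eq s u ::ₘ Δ)) : Cumul σ Γ (Fml.eq t u ::ₘ Δ) := by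
  have e : ∀ v, (Fml.eq (t.lift 0) (.bvar 0)).inst0 v = Fml.eq t v := fun v => by
    simp [Fml.inst0, Fml.inst, Tm.inst, Tm.inst_lift]
  refine cutAdmissible_of_atomic (A := Fml.eq t s) trivial
    (h₁.mono (fun _ m => m) (Multiset.cons_subset_cons (Multiset.subset_cons _ _))) ?_
  refine cutAdmissible_of_atomic (A := Fml.eq s u) trivial
    ((h₂.weaken_left _).mono (fun _ m => m)
      (Multiset.cons_subset_cons (Multiset.subset_cons _ _))) ?_
  refine eqI (Fml.eq (t.lift 0) (.bvar 0)) s u trivial (by simp) (by simp [e]) ?_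
  exact ax (Fml.eq t u) (by simp [e]) (by simp)

/-- A principal cut is reducible to cuts of smaller degree. -/
theorem of_leftPremises_of_rightPremises {A : Fml σ} (hA : ¬ A.Atomic)
    (cut : ∀ B : Fml σ, B.deg < A.deg → CutAdmissible B) {Γ Δ : Multiset (Fml σ)}
    (hl : LeftPremises A Γ Δ) (hr : RightPremises A Γ Δ) : Cumul σ Γ Δ := by
  cases A with
  | atom | eq | ext => exact absurd trivial hA
  | neg A => exact cut A (by simp [Fml.deg]) hl hr
  | conj A B =>
    exact cut B (by simp only [Fml.deg]; omega) hr.2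
      (cut A (by simp only [Fml.deg]; omega) (hr.1.weaken_left _) hl)
  | disj A B =>
    exact cut B (by simp only [Fml.deg]; omega)
      (cut A (by simp only [Fml.deg]; omega) hr (hl.1.weaken_right _)) hl.2
  | imp A B =>
    exact cut B (by simp only [Fml.deg]; omega)
      (cut A (by simp only [Fml.deg]; omega)
        (hl.1.mono (fun _ m => m) (Multiset.cons_subset_cons (Multiset.subset_cons _ _))) hr) hl.2
  | all A =>
    obtain ⟨t, e, h⟩ := hl
    exact cut (A.inst0 t) (by simp [Fml.deg, Fml.deg_inst0]) ((hr t).contract_left e) h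
  | ex A =>
    obtain ⟨t, e, h⟩ := hr
    exact cut (A.inst0 t) (by simp [Fml.deg, Fml.deg_inst0]) h
      ((hl t).contract_left (Multiset.mem_cons_of_mem e))
  | iq F G =>
    obtain ⟨t, e, hF, hG, hU⟩ := hr
    have cF : ∀ s, CutAdmissible (F.inst0 s) := fun s =>
      cut _ (by simp only [Fml.deg, Fml.deg_inst0]; omega)
    have cG : ∀ s, CutAdmissible (G.inst0 s) := fun s =>
      cut _ (by simp only [Fml.deg, Fml.deg_inst0]; omega)
    have uniq : ∀ s, Fml.ext s ∈ Γ → Cumul σ Γ (F.inst0 s ::ₘ Δ) →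
        Cumul σ Γ (Fml.eq s t ::ₘ Δ) := fun s es hs =>
      cF s (hs.mono (fun _ m => m) (Multiset.cons_subset_cons (Multiset.subset_cons _ _)))
        ((hU s).contract_left (Multiset.mem_cons_of_mem es))
    have inst : (∀ s, Cumul σ (F.inst0 s ::ₘ Fml.ext s ::ₘ Γ) Δ) → Cumul σ Γ Δ := fun i =>
      cF t hF ((i t).mono (Multiset.cons_subset_cons (Multiset.cons_subset.2 ⟨e, fun _ m => m⟩))
        fun _ m => m)
    rcases hl with ⟨-, -, -, -, k⟩ | ⟨rfl, t₁, t₂, e₁, e₂, i, j, k⟩ | ⟨rfl, i⟩ |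
      ⟨t₁, t₂, rfl, e₁, e₂, i, j⟩ | ⟨_, rfl, -, i⟩
    · refine cG t hG (cF t (hF.weaken_left _) ?_)
      refine (k t).mono (Multiset.cons_subset_cons (Multiset.cons_subset_cons ?_)) fun _ m => m
      exact Multiset.cons_subset.2 ⟨e, fun _ m => m⟩
    · exact cutAdmissible_of_atomic (A := Fml.eq t₁ t₂) trivial
        (eq_trans (uniq t₁ e₁ i) (eq_symm (uniq t₂ e₂ j))) k
    · exact inst i
    · have hG' : Cumul σ Γ (Fml.eq t t₂ ::ₘ Δ) := by
        simpa [Fml.inst0, Fml.inst, Tm.inst, Tm.inst_lift] using hG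
      exact cutAdmissible_of_atomic (A := Fml.eq t₁ t₂) trivial (eq_trans (uniq t₁ e₁ i) hG') j
    · exact inst i

theorem cutAdmissible (A : Fml σ) : CutAdmissible A := by
  induction hd : A.deg using Nat.strong_induction_on generalizing A with
  | _ d ih =>
    subst hd
    by_cases hA : A.Atomic
    · exact cutAdmissible_of_atomic hA
    intro h₁ h₂
    refine remove_left hA h₂ (fun _ m => m) (fun _ m => m) fun Γ' Δ' l r q => ?_
    rcases q with m | q
    · exact h₁.mono l (Multiset.cons_subset.2 ⟨m, r⟩)
    refine remove_right h₁ l (Multiset.cons_subset_cons r) fun Γ'' Δ'' l' r' q' => ?_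
    have q := q.mono l' r'
    rcases q' with m | q'
    · exact of_leftPremises hA m q
    · exact of_leftPremises_of_rightPremises hA (fun B hB => ih _ hB B rfl) q q'

end Cumul

/-- Every substitution instance of a derivable sequent is derivable in the cumulative
cut-free calculus. -/
theorem DerS.toCumul {σ : Sig} {P : Fml σ → Prop} {Γ Δ : Multiset (Fml σ)} (h : DerS σ P Γ Δ) :
    ∀ θ : ℕ → Tm σ, Cumul σ (Γ.map (Fml.sub θ)) (Δ.map (Fml.sub θ)) := by
  have c : ∀ {A : Fml σ} {Γ Γ'}, Γ ⊆ Γ' → A ::ₘ Γ ⊆ A ::ₘ Γ' := Multiset.cons_subset_cons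
  have s : ∀ {A : Fml σ} {Γ : Multiset (Fml σ)}, Γ ⊆ A ::ₘ Γ := by
    intro _ _ _ m; simp [m]
  have ss : ∀ {A B : Fml σ} {Γ : Multiset (Fml σ)}, Γ ⊆ A ::ₘ B ::ₘ Γ := by
    intro _ _ _ _ m; simp [m]
  have sss : ∀ {A B C : Fml σ} {Γ : Multiset (Fml σ)}, Γ ⊆ A ::ₘ B ::ₘ C ::ₘ Γ := by
    intro _ _ _ _ _ m; simp [m]
  have z : ∀ {Γ : Multiset (Fml σ)}, Γ ⊆ Γ := by intro _ _ m; exact m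
  have ext_update : ∀ (θ : ℕ → Tm σ) (a : ℕ) (t : Tm σ),
      (Fml.ext (.par a)).sub (Function.update θ a t) = Fml.ext t := fun θ a t => by
    simp [Fml.sub, Tm.sub]
  have eq_update : ∀ (θ : ℕ → Tm σ) {a : ℕ} (u : Tm σ) {t : Tm σ}, a ∉ t.pars →
      (Fml.eq (.par a) t).sub (Function.update θ a u) = Fml.eq u (t.sub θ) :=
    fun θ a u t h => by simp [Fml.sub, Tm.sub, Tm.sub_update h]
  have eq_var : ∀ (θ : ℕ → Tm σ) (t : Tm σ), (Fml.eq (.bvar 0) (t.lift 0)).sub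
      (fun a => (θ a).lift 0) = Fml.eq (.bvar 0) ((t.sub θ).lift 0) := fun θ t => by
    simp [Fml.sub, Tm.sub, Tm.sub_lift]
  induction h with
  | ax A => exact fun θ => .ax (A.sub θ) (by simp) (by simp)
  | cut A _ _ _ i j =>
    intro θ
    have i := i θ
    have j := j θ
    simp only [Multiset.map_cons, Multiset.map_add] at i j ⊢
    refine Cumul.cutAdmissible (A.sub θ) (i.mono ?_ (c ?_)) (j.mono (c ?_) ?_) <;>
      intro _ m <;> simp only [Multiset.mem_add, m, true_or, or_true]
  | lw A _ i =>
    intro θ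
    rw [Multiset.map_cons]
    exact (i θ).mono s z
  | rw A _ i =>
    intro θ
    rw [Multiset.map_cons]
    exact (i θ).mono z s
  | lc A _ i =>
    intro θ
    have i := i θ
    simp only [Multiset.map_cons] at i ⊢
    exact i.mono (Multiset.cons_subset.2 ⟨by simp, z⟩) z
  | rc A _ i =>
    intro θ
    have i := i θ
    simp only [Multiset.map_cons] at i ⊢
    exact i.mono z (Multiset.cons_subset.2 ⟨by simp, z⟩)
  | lneg A _ i =>
    intro θ
    have i := i θ
    simp only [Multiset.map_cons, Fml.sub] at i ⊢
    exact .lneg _ (by simp) (i.mono s z)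
  | rneg A _ i =>
    intro θ
    have i := i θ
    simp only [Multiset.map_cons, Fml.sub] at i ⊢
    exact .rneg _ (Multiset.mem_cons_self _ _) (i.mono z s)
  | land A B _ i =>
    intro θ
    have i := i θ
    simp only [Multiset.map_cons, Fml.sub] at i ⊢
    exact .land _ _ (Multiset.mem_cons_self _ _) (i.mono (c (c s)) z)
  | rand A B _ _ i j =>
    intro θ
    have i := i θ
    have j := j θ
    simp only [Multiset.map_cons, Fml.sub] at i j ⊢
    exact .rand _ _ (Multiset.mem_cons_self _ _) (i.mono z (c s)) (j.mono z (c s))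
  | lor A B _ _ i j =>
    intro θ
    have i := i θ
    have j := j θ
    simp only [Multiset.map_cons, Fml.sub] at i j ⊢
    exact .lor _ _ (Multiset.mem_cons_self _ _) (i.mono (c s) z) (j.mono (c s) z)
  | ror A B _ i =>
    intro θ
    have i := i θ
    simp only [Multiset.map_cons, Fml.sub] at i ⊢
    exact .ror _ _ (Multiset.mem_cons_self _ _) (i.mono z (c (c s)))
  | limp A B _ _ i j =>
    intro θ
    have i := i θ
    have j := j θ
    simp only [Multiset.map_cons, Fml.sub] at i j ⊢
    exact .limp _ _ (Multiset.mem_cons_self _ _) (i.mono s z) (j.mono (c s) z)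
  | rimp A B _ i =>
    intro θ
    have i := i θ
    simp only [Multiset.map_cons, Fml.sub] at i ⊢
    exact .rimp _ _ (Multiset.mem_cons_self _ _) (i.mono z (c s))
  | lall A t _ i =>
    intro θ
    have i := i θ
    simp only [Multiset.map_cons, Fml.sub, Fml.sub_inst0] at i ⊢
    exact .lall _ (t.sub θ) (by simp) (by simp) (i.mono (c ss) z)
  | rall A a hΓ hΔ hA _ i =>
    intro θ
    have i := fun t => i (Function.update θ a t)
    simp only [Multiset.map_cons, ext_update, hΓ.map_sub_update, hΔ.map_sub_update,
      Fml.sub_update_inst0 hA] at i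
    simp only [Multiset.map_cons, Fml.sub]
    exact .rall _ (Multiset.mem_cons_self _ _) fun t => (i t).mono z (c s)
  | lex A a hΓ hΔ hA _ i =>
    intro θ
    have i := fun t => i (Function.update θ a t)
    simp only [Multiset.map_cons, ext_update, hΓ.map_sub_update, hΔ.map_sub_update,
      Fml.sub_update_inst0 hA] at i
    simp only [Multiset.map_cons, Fml.sub]
    exact .lex _ (Multiset.mem_cons_self _ _) fun t => (i t).mono (c (c s)) z
  | rex A t _ i =>
    intro θ
    have i := i θ
    simp only [Multiset.map_cons, Fml.sub, Fml.sub_inst0] at i ⊢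
    exact .rex _ (t.sub θ) (Multiset.mem_cons_self _ _) (Multiset.mem_cons_self _ _)
      (i.mono s (c s))
  | eqI A t₁ t₂ hA _ i =>
    intro θ
    have i := i θ
    simp only [Multiset.map_cons, Fml.sub_inst0] at i ⊢
    exact .eqI _ (t₁.sub θ) (t₂.sub θ) (hA.sub _) (Multiset.mem_cons_self _ _) (by simp)
      (i.mono (c ss) z)
  | eqE t _ i =>
    intro θ
    have i := i θ
    simp only [Multiset.map_cons, Fml.sub] at i
    exact .eqE _ i
  | riS F G t a hΓ hΔ hF hG ht _ _ _ i j k =>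
    intro θ
    have i := i θ
    have j := j θ
    have k := fun u => k (Function.update θ a u)
    simp only [Multiset.map_cons, ext_update, eq_update θ _ ht, hΓ.map_sub_update,
      hΔ.map_sub_update, Fml.sub_update_inst0 hF] at k
    simp only [Multiset.map_cons, Fml.sub, Fml.sub_inst0] at i j ⊢
    exact .ri _ _ (t.sub θ) (Multiset.mem_cons_self _ _) (Multiset.mem_cons_self _ _)
      (i.mono s (c s)) (j.mono s (c s)) fun u => (k u).mono (c (c s)) (c s)
  | li1S F G t a b hΓ hΔ hF hG ht hΓ' hΔ' hF' hG' ht' _ _ _ i j k =>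
    intro θ
    have i := i θ
    have j := fun u => j (Function.update θ a u)
    have k := fun u => k (Function.update θ b u)
    simp only [Multiset.map_cons, ext_update, eq_update θ _ ht, hΓ.map_sub_update,
      hΔ.map_sub_update, Fml.sub_update_inst0 hF] at j
    simp only [Multiset.map_cons, ext_update, hΓ'.map_sub_update,
      hΔ'.map_sub_update, Fml.sub_update_inst0 hF', Fml.sub_update_inst0 hG'] at k
    simp only [Multiset.map_cons, Fml.sub, Fml.sub_inst0] at i ⊢
    exact .li1 _ _ (t.sub θ) (by simp) (Multiset.mem_cons_self _ _) (i.mono ss z)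
      (fun u => (j u).mono (c (c ss)) z) fun u => (k u).mono (c (c (c ss))) z
  | li2SI F t₁ t₂ _ _ _ i j k =>
    intro θ
    have i := i θ
    have j := j θ
    have k := k θ
    simp only [Multiset.map_cons, Fml.sub, Fml.sub_inst0] at i j k ⊢
    exact .li2 _ (t₁.sub θ) (t₂.sub θ) (by simp [Fml.exG, Fml.sub, Tm.sub]) (by simp) (by simp)
      (i.mono sss z) (j.mono sss z) (k.mono (c sss) z)
  | li3 F a hΓ hΔ hF _ i =>
    intro θ
    have i := fun t => i (Function.update θ a t)
    simp only [Multiset.map_cons, ext_update, hΓ.map_sub_update, hΔ.map_sub_update,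
      Fml.sub_update_inst0 hF] at i
    rw [Multiset.map_cons]
    exact .li3 _ (Multiset.mem_cons_self _ _) fun t => (i t).mono (c (c s)) z
  | li4SI F t₁ t₂ _ _ i j =>
    intro θ
    have i := i θ
    have j := j θ
    simp only [Multiset.map_cons, Fml.sub, Fml.sub_inst0] at i j
    rw [Multiset.map_cons, Multiset.map_cons, Multiset.map_cons, Fml.sub, Fml.sub, Fml.sub, eq_var]
    exact .li4 _ (t₁.sub θ) (t₂.sub θ) (by simp) (by simp) (by simp)
      (i.mono sss z) (j.mono (c sss) z)
  | li5S F t a hΓ hΔ hF ht _ i =>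
    intro θ
    have i := fun t => i (Function.update θ a t)
    simp only [Multiset.map_cons, ext_update, hΓ.map_sub_update, hΔ.map_sub_update,
      Fml.sub_update_inst0 hF] at i
    rw [Multiset.map_cons, Multiset.map_cons, Fml.sub, Fml.sub, eq_var]
    exact .li5 _ (t.sub θ) (by simp) (by simp) fun t => (i t).mono (c (c ss)) z

/-- **Cut elimination for the simplified system GPFL=^{IS}.**  For every
sequent `Γ ⇒ Δ` provable in GPFL=^{IS} there is a proof of `Γ ⇒ Δ` in
GPFL=^{IS} that contains no application of the Cut rule. -/
theorem cut_elimination_simplified {σ : Sig} {Γ Δ : Multiset (Fml σ)}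
    (h : DerS σ (fun _ => True) Γ Δ) :
    DerS σ (fun _ => False) Γ Δ := by
  simpa [Fml.sub_par] using (h.toCumul Tm.par).toDerS
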